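/- (Soundness of loop formulas) Let P be a FASP program and LF(P) the set of loop formulas of all loops of P. Then any interpretation I of P that is a model of LF(P) ∪ comp(P) is an answer set of P. -/

import Mathlib

/-- A t-norm on `[0,1]`: an increasing (in each argument), commutative and associative
binary operator on `[0,1]` with neutral element `1`. -/
structure Tnorm where
  T : ℝ → ℝ → ℝ
  mem_Icc : ∀ x ∈ Set.Icc (0:ℝ) 1, ∀ y ∈ Set.Icc (0:ℝ) 1, T x y ∈ Set.Icc (0:ℝ) 1
  mono : ∀ x ∈ Set.Icc (0:ℝ) 1, ∀ x' ∈ Set.Icc (0:ℝ) 1, ∀ y ∈ Set.Icc (0:ℝ) 1,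
    ∀ y' ∈ Set.Icc (0:ℝ) 1, x ≤ x' → y ≤ y' → T x y ≤ T x' y'
  comm : ∀ x ∈ Set.Icc (0:ℝ) 1, ∀ y ∈ Set.Icc (0:ℝ) 1, T x y = T y x
  assoc : ∀ x ∈ Set.Icc (0:ℝ) 1, ∀ y ∈ Set.Icc (0:ℝ) 1, ∀ z ∈ Set.Icc (0:ℝ) 1,
    T (T x y) z = T x (T y z)
  one_T : ∀ x ∈ Set.Icc (0:ℝ) 1, T 1 x = x

/-- Left continuity of a t-norm in each argument (on `[0,1]`). -/
def Tnorm.LeftContinuous (Tn : Tnorm) : Prop :=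
  ∀ x ∈ Set.Icc (0:ℝ) 1, ∀ y ∈ Set.Icc (0:ℝ) 1,
    ContinuousWithinAt (fun t => Tn.T x t) (Set.Icc (0:ℝ) y) y ∧
    ContinuousWithinAt (fun t => Tn.T t y) (Set.Icc (0:ℝ) x) x

/-- The residual implicator of a t-norm: `I_T(x,y) = sup { λ ∈ [0,1] | T(x,λ) ≤ y }`. -/
noncomputable def Tnorm.resid (Tn : Tnorm) (x y : ℝ) : ℝ :=
  sSup { l | l ∈ Set.Icc (0:ℝ) 1 ∧ Tn.T x l ≤ y }

/-- The n-ary extension of a t-norm: `T(b) = b`, `T(b₁,…,bₙ) = T(b₁, T(b₂,…,bₙ))`. -/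
def Tnorm.listEval (Tn : Tnorm) : List ℝ → ℝ
  | [] => 1
  | [x] => x
  | x :: xs => Tn.T x (Tn.listEval xs)

/-- A negator: a decreasing `[0,1] → [0,1]` map with `N(0) = 1` and `N(1) = 0`. -/
structure Negator where
  N : ℝ → ℝ
  mem_Icc : ∀ x ∈ Set.Icc (0:ℝ) 1, N x ∈ Set.Icc (0:ℝ) 1
  anti : ∀ x ∈ Set.Icc (0:ℝ) 1, ∀ y ∈ Set.Icc (0:ℝ) 1, x ≤ y → N y ≤ N x
  N_zero : N 0 = 1
  N_one : N 1 = 0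

/-- A body element of a FASP rule: an atom, a constant from `[0,1]`, or a negated atom. -/
inductive Lit (α : Type*) where
  | pos : α → Lit α
  | const : ℝ → Lit α
  | neg : Negator → α → Lit α

/-- A FASP rule `a ← T(b₁,…,bₙ)`: a head (an atom or a constant in `[0,1]`), a body
(a list of extended literals, combined by the rule's t-norm). -/
structure Rule (α : Type*) where
  head : α ⊕ ℝ
  body : List (Lit α)
  tnorm : Tnorm

/-- Well-formedness of a literal: constants must lie in `[0,1]`. -/
def Lit.WF {α : Type*} : Lit α → Prop
  | .const c => c ∈ Set.Icc (0:ℝ) 1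
  | _ => True

/-- Well-formedness of a rule: nonempty body, constants in `[0,1]`, and a
left-continuous t-norm. -/
def Rule.WF {α : Type*} (r : Rule α) : Prop :=
  r.body ≠ [] ∧ (∀ l ∈ r.body, l.WF) ∧ r.tnorm.LeftContinuous ∧
    ∀ c : ℝ, r.head = Sum.inr c → c ∈ Set.Icc (0:ℝ) 1

/-- Well-formedness of a FASP program (a set of rules). -/
def ProgramWF {α : Type*} (P : Set (Rule α)) : Prop := ∀ r ∈ P, r.WF

/-- An interpretation maps every atom to a value in `[0,1]`. -/
def IsInterp {α : Type*} (I : α → ℝ) : Prop := ∀ a, I a ∈ Set.Icc (0:ℝ) 1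

/-- Evaluation of an extended literal: `I(c) = c`, `I(N(b)) = N(I(b))`. -/
def Lit.eval {α : Type*} (I : α → ℝ) : Lit α → ℝ
  | .pos a => I a
  | .const c => c
  | .neg n a => n.N (I a)

/-- Evaluation of a rule body: `I(body(r)) = T_r(I(b₁),…,I(bₙ))`. -/
def Rule.evalBody {α : Type*} (I : α → ℝ) (r : Rule α) : ℝ :=
  r.tnorm.listEval (r.body.map (Lit.eval I))

/-- Evaluation of a rule head. -/
def evalHead {α : Type*} (I : α → ℝ) : α ⊕ ℝ → ℝ
  | .inl a => I a
  | .inr c => c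

/-- The atoms occurring positively (non-negated) in the body of a rule. -/
def Rule.posbody {α : Type*} (r : Rule α) : Set α := { a | Lit.pos a ∈ r.body }

/-- The immediate consequence operator:
`Π_P(I)(a) = sup { I(body(r)) | r ∈ P_a }` (with `sup ∅ = 0`). -/
noncomputable def PiOp {α : Type*} (P : Set (Rule α)) (I : α → ℝ) : α → ℝ :=
  fun a => sSup { x | ∃ r ∈ P, r.head = Sum.inl a ∧ x = r.evalBody I }

/-- `I` is a model of `P` iff `I(r) = I_r(I(body(r)), I(head(r))) = 1` for all `r ∈ P`. -/
def IsModel {α : Type*} (P : Set (Rule α)) (I : α → ℝ) : Prop :=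
  ∀ r ∈ P, r.tnorm.resid (r.evalBody I) (evalHead I r.head) = 1

/-- The support of an interpretation: `supp(I) = { a | I(a) > 0 }`. -/
def supp {α : Type*} (I : α → ℝ) : Set α := { a | 0 < I a }

/-- `U` is unfounded w.r.t. `I`: for each `u ∈ U` and rule `r ∈ P_u`, either
`U ∩ posbody(r) ≠ ∅`, or `I(u) > I(body(r))`, or `I(body(r)) = 0`. -/
def Unfounded {α : Type*} (P : Set (Rule α)) (I : α → ℝ) (U : Set α) : Prop :=
  ∀ u ∈ U, ∀ r ∈ P, r.head = Sum.inl u →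
    (U ∩ r.posbody).Nonempty ∨ r.evalBody I < I u ∨ r.evalBody I = 0

/-- `I` is unfounded-free iff `supp(I) ∩ U = ∅` for every unfounded set `U`. -/
def UnfoundedFree {α : Type*} (P : Set (Rule α)) (I : α → ℝ) : Prop :=
  ∀ U : Set α, Unfounded P I U → supp I ∩ U = ∅

/-- An answer set of `P` is an unfounded-free model of `P`. -/
def IsAnswerSet {α : Type*} (P : Set (Rule α)) (I : α → ℝ) : Prop :=
  IsModel P I ∧ UnfoundedFree P I

/-- The reduct of a literal w.r.t. `I`: every negated atom `N(b)` is replaced by the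
constant `N(I(b))`. -/
def Lit.reduct {α : Type*} (I : α → ℝ) : Lit α → Lit α
  | .neg n a => .const (n.N (I a))
  | l => l

/-- The reduct of a rule w.r.t. `I`. -/
def Rule.reduct {α : Type*} (I : α → ℝ) (r : Rule α) : Rule α :=
  ⟨r.head, r.body.map (Lit.reduct I), r.tnorm⟩

/-- The reduct of a program: `P^I = { r^I | r ∈ P }`. -/
def reduct {α : Type*} (P : Set (Rule α)) (I : α → ℝ) : Set (Rule α) :=
  (Rule.reduct I) '' P

/-- `F` is the least fixpoint of `Π_P` (among interpretations). -/
def IsLfp {α : Type*} (P : Set (Rule α)) (F : α → ℝ) : Prop :=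
  IsInterp F ∧ PiOp P F = F ∧
    ∀ G : α → ℝ, IsInterp G → PiOp P G = G → ∀ a, F a ≤ G a

/-- `I` is a model of the completion `comp(P)`: for every atom `a`,
`I(a) = sup { I(body(r)) | r ∈ P_a }` (with `sup ∅ = 0`), and for every rule with a
constant head `c`, `I(body(r)) ≤ c`. -/
def ModelsComp {α : Type*} (P : Set (Rule α)) (I : α → ℝ) : Prop :=
  (∀ a, I a = sSup { x | ∃ r ∈ P, r.head = Sum.inl a ∧ x = r.evalBody I }) ∧
  (∀ r ∈ P, ∀ c : ℝ, r.head = Sum.inr c → r.evalBody I ≤ c)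

/-- Edge of the positive dependency graph of `P`: `(a,b)` iff some rule with head `a`
has `b` occurring positively in its body. -/
def depEdge {α : Type*} (P : Set (Rule α)) (a b : α) : Prop :=
  ∃ r ∈ P, r.head = Sum.inl a ∧ b ∈ r.posbody

/-- A loop of `P`: a nonempty set `L` of atoms such that any two elements of `L` are
joined by a path of positive length in the positive dependency graph all of whose
vertices lie in `L`. -/
def IsLoop {α : Type*} (P : Set (Rule α)) (L : Set α) : Prop :=
  L.Nonempty ∧ ∀ a ∈ L, ∀ b ∈ L,
    Relation.TransGen (fun u v => depEdge P u v ∧ u ∈ L ∧ v ∈ L) a b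

/-- `R⁻(P,L)`: the rules of `P` with head in `L` whose positive body is disjoint
from `L`. -/
def extRules {α : Type*} (P : Set (Rule α)) (L : Set α) : Set (Rule α) :=
  { r | r ∈ P ∧ (∃ a ∈ L, r.head = Sum.inl a) ∧ r.posbody ∩ L = ∅ }

/-- `I` satisfies the loop formula `LF(L,P)` iff
`max { I(l) | l ∈ L } ≤ max { I(body(r)) | r ∈ R⁻(P,L) }` (right-hand side `0` when
`R⁻(P,L) = ∅`). -/
def SatLF {α : Type*} (P : Set (Rule α)) (L : Set α) (I : α → ℝ) : Prop :=
  sSup (I '' L) ≤ sSup { x | ∃ r ∈ extRules P L, x = r.evalBody I }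

/-- A simple program: no rule body contains a negated atom. -/
def Simple {α : Type*} (P : Set (Rule α)) : Prop :=
  ∀ r ∈ P, ∀ l ∈ r.body, ∀ (n : Negator) (a : α), l ≠ Lit.neg n a

theorem Tnorm.T_one (Tn : Tnorm) {x : ℝ} (hx : x ∈ Set.Icc (0:ℝ) 1) : Tn.T x 1 = x := by
  rw [Tn.comm x hx 1 (by simp), Tn.one_T x hx]

theorem Tnorm.T_le_left (Tn : Tnorm) {x y : ℝ} (hx : x ∈ Set.Icc (0:ℝ) 1)
    (hy : y ∈ Set.Icc (0:ℝ) 1) : Tn.T x y ≤ x :=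
  (Tn.mono x hx x hx y hy 1 (by simp) le_rfl hy.2).trans_eq (Tn.T_one hx)

theorem Tnorm.T_le_right (Tn : Tnorm) {x y : ℝ} (hx : x ∈ Set.Icc (0:ℝ) 1)
    (hy : y ∈ Set.Icc (0:ℝ) 1) : Tn.T x y ≤ y :=
  (Tn.comm x hx y hy).trans_le (Tn.T_le_left hy hx)

theorem Tnorm.listEval_mem_Icc (Tn : Tnorm) :
    ∀ l : List ℝ, (∀ x ∈ l, x ∈ Set.Icc (0:ℝ) 1) → Tn.listEval l ∈ Set.Icc (0:ℝ) 1
  | [], _ => by simp [Tnorm.listEval]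
  | [x], h => h x (by simp)
  | x :: y :: l, h => Tn.mem_Icc x (h x (by simp)) _
      (Tn.listEval_mem_Icc (y :: l) fun z hz => h z (List.mem_cons_of_mem x hz))

theorem Tnorm.listEval_le (Tn : Tnorm) :
    ∀ l : List ℝ, (∀ x ∈ l, x ∈ Set.Icc (0:ℝ) 1) → ∀ x ∈ l, Tn.listEval l ≤ x
  | [], _, _, hz => absurd hz List.not_mem_nil
  | [x], _, z, hz => by
      rw [List.mem_singleton.1 hz]
      exact le_rfl
  | x :: y :: l, h, z, hz => by
      have ht : ∀ z ∈ y :: l, z ∈ Set.Icc (0:ℝ) 1 := fun z hz => h z (List.mem_cons_of_mem x hz)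
      have hx := h x (by simp)
      have hl := Tn.listEval_mem_Icc (y :: l) ht
      rcases List.mem_cons.1 hz with rfl | hz
      · exact Tn.T_le_left hx hl
      · exact (Tn.T_le_right hx hl).trans (Tn.listEval_le (y :: l) ht z hz)

/-- The residual implicator takes the value `1` at `x ≤ y`. -/
theorem Tnorm.resid_eq_one (Tn : Tnorm) {x y : ℝ} (hx : x ∈ Set.Icc (0:ℝ) 1) (hxy : x ≤ y) :
    Tn.resid x y = 1 :=
  IsGreatest.csSup_eq (s := { l | l ∈ Set.Icc (0:ℝ) 1 ∧ Tn.T x l ≤ y })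
    ⟨⟨by simp, (Tn.T_one hx).trans_le hxy⟩, fun _ hl => hl.1.2⟩

theorem Lit.eval_mem_Icc {α : Type*} {I : α → ℝ} (hI : IsInterp I) {l : Lit α} (hl : l.WF) :
    l.eval I ∈ Set.Icc (0:ℝ) 1 := by
  cases l with
  | pos a => exact hI a
  | const c => exact hl
  | neg n a => exact n.mem_Icc _ (hI a)

theorem Rule.WF.map_eval_mem_Icc {α : Type*} {I : α → ℝ} (hI : IsInterp I) {r : Rule α}
    (hr : r.WF) : ∀ x ∈ r.body.map (Lit.eval I), x ∈ Set.Icc (0:ℝ) 1 := by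
  intro x hx
  obtain ⟨l, hl, rfl⟩ := List.mem_map.1 hx
  exact Lit.eval_mem_Icc hI (hr.2.1 l hl)

theorem Rule.WF.evalBody_mem_Icc {α : Type*} {I : α → ℝ} (hI : IsInterp I) {r : Rule α}
    (hr : r.WF) : r.evalBody I ∈ Set.Icc (0:ℝ) 1 :=
  r.tnorm.listEval_mem_Icc _ (hr.map_eval_mem_Icc hI)

theorem Rule.WF.evalBody_le {α : Type*} {I : α → ℝ} (hI : IsInterp I) {r : Rule α}
    (hr : r.WF) {a : α} (ha : a ∈ r.posbody) : r.evalBody I ≤ I a :=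
  r.tnorm.listEval_le _ (hr.map_eval_mem_Icc hI) _ (List.mem_map.2 ⟨_, ha, rfl⟩)

theorem ModelsComp.evalBody_le_head {α : Type*} {P : Set (Rule α)} (hwf : ProgramWF P) {I : α → ℝ}
    (hI : IsInterp I) (hcomp : ModelsComp P I) {r : Rule α} (hr : r ∈ P) :
    r.evalBody I ≤ evalHead I r.head := by
  cases h : r.head with
  | inl a =>
    rw [evalHead, hcomp.1 a]
    refine le_csSup ⟨1, ?_⟩ ⟨r, hr, h, rfl⟩
    rintro _ ⟨r', hr', -, rfl⟩
    exact ((hwf r' hr').evalBody_mem_Icc hI).2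
  | inr c => exact hcomp.2 r hr c h

theorem ModelsComp.isModel {α : Type*} {P : Set (Rule α)} (hwf : ProgramWF P) {I : α → ℝ}
    (hI : IsInterp I) (hcomp : ModelsComp P I) : IsModel P I := fun r hr =>
  r.tnorm.resid_eq_one ((hwf r hr).evalBody_mem_Icc hI) (hcomp.evalBody_le_head hwf hI hr)

/-- A positive supremum of body values over finitely many rules is attained. -/
theorem exists_evalBody_eq_sSup {α : Type*} {Q : Set (Rule α)} (hQ : Q.Finite) {I : α → ℝ}
    (h : 0 < sSup { x | ∃ r ∈ Q, x = r.evalBody I }) :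
    ∃ r ∈ Q, r.evalBody I = sSup { x | ∃ r ∈ Q, x = r.evalBody I } := by
  have hne : { x | ∃ r ∈ Q, x = r.evalBody I }.Nonempty := by
    by_contra hne
    rw [Set.not_nonempty_iff_eq_empty.1 hne, Real.sSup_empty] at h
    exact lt_irrefl _ h
  have hf : { x | ∃ r ∈ Q, x = r.evalBody I }.Finite :=
    (hQ.image fun r => r.evalBody I).subset fun x ⟨r, hr, hx⟩ => ⟨r, hr, hx.symm⟩
  obtain ⟨r, hr, hx⟩ := hne.csSup_mem hf
  exact ⟨r, hr, hx.symm⟩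

theorem ModelsComp.exists_evalBody_eq {α : Type*} {P : Set (Rule α)} (hfin : P.Finite) {I : α → ℝ}
    (hcomp : ModelsComp P I) {a : α} (ha : 0 < I a) :
    ∃ r ∈ P, r.head = Sum.inl a ∧ r.evalBody I = I a := by
  have h : I a = sSup { x | ∃ r ∈ {r ∈ P | r.head = Sum.inl a}, x = r.evalBody I } := by
    rw [hcomp.1 a]
    simp only [Set.mem_ofPred_eq, and_assoc]
  obtain ⟨r, hr, hx⟩ := exists_evalBody_eq_sSup (hfin.sep _) (h ▸ ha)
  exact ⟨r, hr.1, hr.2, hx.trans h.symm⟩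

/-- In a finite set of atoms each of which has a successor in the set, there is a loop closed
under taking successors in the set. -/
theorem exists_isLoop_closed {α : Type*} [Finite α] {P : Set (Rule α)} {M : Set α}
    (hM : M.Nonempty) (hsucc : ∀ u ∈ M, ∃ v ∈ M, depEdge P u v) :
    ∃ L ⊆ M, IsLoop P L ∧ ∀ u ∈ L, ∀ v ∈ M, depEdge P u v → v ∈ L := by
  let E : α → α → Prop := fun u v => depEdge P u v ∧ u ∈ M ∧ v ∈ M
  obtain ⟨x, hx, hmin⟩ := Set.exists_min_image M (fun x => { y | Relation.TransGen E x y }.ncard)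
    M.toFinite hM
  have hsub : { y | Relation.TransGen E x y } ⊆ M := by
    intro y hy
    cases hy with
    | single h => exact h.2.2
    | tail _ h => exact h.2.2
  have hconn : ∀ a b, Relation.TransGen E x a → Relation.TransGen E x b →
      Relation.TransGen E a b := by
    intro a b ha hb
    have h : { y | Relation.TransGen E a y } = { y | Relation.TransGen E x y } :=
      Set.eq_of_subset_of_ncard_le (fun y hy => ha.trans hy) (hmin a (hsub ha)) (Set.toFinite _)
    exact h.symm.subset hb
  refine ⟨{ y | Relation.TransGen E x y }, hsub, ⟨?_, fun a ha b hb => ?_⟩,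
    fun u hu v hv huv => hu.tail ⟨huv, hsub hu, hv⟩⟩
  · obtain ⟨v, hv, hxv⟩ := hsucc x hx
    exact ⟨v, .single ⟨hxv, hx, hv⟩⟩
  · have hab := hconn a b ha hb
    clear hb
    induction hab with
    | single h => exact .single ⟨h.1, ha, ha.tail h⟩
    | tail hac h ih => exact ih.tail ⟨h.1, ha.trans hac, (ha.trans hac).tail h⟩

/-- Soundness of loop formulas: any interpretation `I` of `P` that is
a model of `LF(P) ∪ comp(P)` (the completion together with the loop formulas of all
loops of `P`) is an answer set of `P`. -/
theorem modelsComp_and_loopFormulas_answerSet {α : Type*} [Finite α]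
    (P : Set (Rule α)) (hfin : P.Finite) (hwf : ProgramWF P)
    (I : α → ℝ) (hI : IsInterp I)
    (hcomp : ModelsComp P I) (hlf : ∀ L : Set α, IsLoop P L → SatLF P L I) :
    IsAnswerSet P I := by
  refine ⟨hcomp.isModel hwf hI, fun U hU => ?_⟩
  by_contra hne
  obtain ⟨w, ⟨hwU, hwmax⟩⟩ := Set.exists_max_image (supp I ∩ U) I (Set.toFinite _)
    (Set.nonempty_iff_ne_empty.2 hne)
  have hpos : 0 < I w := hwU.1
  let M : Set α := { u | u ∈ U ∧ I u = I w }
  have hstep : ∀ r ∈ P, ∀ u ∈ M, r.head = Sum.inl u → I w ≤ r.evalBody I →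
      ∃ v ∈ M, v ∈ r.posbody := by
    intro r hr u hu hhead hle
    rcases hU u hu.1 r hr hhead with ⟨v, hvU, hv⟩ | h | h
    · have hwv := hle.trans ((hwf r hr).evalBody_le hI hv)
      exact ⟨v, ⟨hvU, (hwmax v ⟨hpos.trans_le hwv, hvU⟩).antisymm hwv⟩, hv⟩
    · exact absurd (h.trans_eq hu.2) hle.not_gt
    · exact absurd (hpos.trans_le hle) h.le.not_gt
  obtain ⟨L, hLM, hL, hclosed⟩ := exists_isLoop_closed (P := P) (M := M) ⟨w, hwU.2, rfl⟩ (by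
    intro u hu
    obtain ⟨r, hr, hhead, hbody⟩ := hcomp.exists_evalBody_eq hfin (hpos.trans_eq hu.2.symm)
    obtain ⟨v, hvM, hv⟩ := hstep r hr u hu hhead (hbody.trans hu.2).ge
    exact ⟨v, hvM, r, hr, hhead, hv⟩)
  obtain ⟨l, hl⟩ := hL.1
  have hsup : I w ≤ sSup { x | ∃ r ∈ extRules P L, x = r.evalBody I } :=
    (hLM hl).2.ge.trans ((le_csSup (Set.toFinite (I '' L)).bddAbove ⟨l, hl, rfl⟩).trans (hlf L hL))
  obtain ⟨r, ⟨hr, ⟨u, hu, hhead⟩, hdisj⟩, hbody⟩ := exists_evalBody_eq_sSup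
    (hfin.subset fun r hr => hr.1) (hpos.trans_le hsup)
  obtain ⟨v, hvM, hv⟩ := hstep r hr u (hLM hu) hhead (hsup.trans_eq hbody.symm)
  exact hdisj.subset ⟨hv, hclosed u hu v hvM ⟨r, hr, hhead, hv⟩⟩
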